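/- Let n ≥ 2 and let Λ₀ be a covering lattice of the unit ball Bⁿ with the property that every covering lattice Λ of Bⁿ with d(Λ) ≥ d(Λ₀) equals U(Λ₀) for some rotation U ∈ SO(n). Then for every ε > 0 there exists ε′ > 0 such that every covering lattice Λ of Bⁿ with d(Λ) > d(Λ₀) − ε′ satisfies δ(Λ, U(Λ₀)) < ε for some rotation U ∈ SO(n). -/

import Mathlib

open Set Pointwise MeasureTheory

noncomputable section

abbrev Euc (n : ℕ) := EuclideanSpace ℝ (Fin n)

/-- An origin-symmetric convex body in `ℝⁿ`: compact, convex, nonempty interior, `K = -K`. -/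
def IsSymmConvexBody {n : ℕ} (K : Set (Euc n)) : Prop :=
  IsCompact K ∧ Convex ℝ K ∧ (interior K).Nonempty ∧ K = -K

/-- The closed Euclidean unit ball `Bⁿ`. -/
def unitBall (n : ℕ) : Set (Euc n) := Metric.closedBall 0 1

/-- The set of integer points `ℤⁿ ⊆ ℝⁿ`. -/
def intPoints (n : ℕ) : Set (Euc n) := {x | ∀ i, ∃ m : ℤ, x i = (m : ℝ)}

/-- The lattice `Λ = T(ℤⁿ)` is a covering lattice for `K`:
the translates of `K` by lattice vectors cover all of `ℝⁿ`. -/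
def IsCoveringLattice {n : ℕ} (T : Euc n →ₗ[ℝ] Euc n) (K : Set (Euc n)) : Prop :=
  (⋃ l ∈ T '' intPoints n, (l +ᵥ K)) = Set.univ

/-- The critical covering determinant `d_K`: the supremum of the determinants
`d(Λ) = |det T|` over all covering lattices `Λ = T(ℤⁿ)` of `K`. -/
def critCoveringDet {n : ℕ} (K : Set (Euc n)) : ℝ :=
  sSup {d | ∃ T : Euc n →ₗ[ℝ] Euc n,
    LinearMap.det T ≠ 0 ∧ IsCoveringLattice T K ∧ d = |LinearMap.det T|}

/-- The Hilbert-Schmidt (Frobenius) norm of a linear map: `√(trace (Mᵀ ∘ M))`. -/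
def hsNorm {n : ℕ} (M : Euc n →ₗ[ℝ] Euc n) : ℝ :=
  Real.sqrt (LinearMap.trace ℝ (Euc n) (LinearMap.adjoint M ∘ₗ M))

/-- A discrete subgroup containing a basis `B` of the ambient space is generated by vectors whose
`B`-coordinates lie in `[0, 1]`. -/
theorem exists_reduced_generators {n : ℕ} {E : Type*} [NormedAddCommGroup E] [NormedSpace ℝ E]
    (Λ : Submodule ℤ E) (hΛ : ∀ s : Set E, Bornology.IsBounded s → (s ∩ Λ).Finite)
    (B : Module.Basis (Fin n) ℝ E) (hB : ∀ i, B i ∈ Λ) :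
    ∃ b : Fin n → E, (∀ i j, B.repr (b i) j ∈ Icc (0 : ℝ) 1) ∧
      Submodule.span ℤ (range b) = Λ := by
  have hbdd : Bornology.IsBounded {x : E | ∀ j, B.repr x j ∈ Icc (0 : ℝ) 1} := by
    refine (Metric.isBounded_closedBall (x := (0 : E)) (r := ∑ j, ‖B j‖)).subset fun x hx => ?_
    rw [mem_closedBall_zero_iff]
    conv_lhs => rw [← B.sum_repr x]
    refine norm_sum_le_of_le _ fun j _ => ?_
    rw [norm_smul, Real.norm_of_nonneg (hx j).1]
    exact mul_le_of_le_one_left (norm_nonneg _) (hx j).2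
  have hmin : ∀ i, ∃ b ∈ Λ, (∀ j, B.repr b j ∈ Icc (0 : ℝ) 1) ∧ (∀ j, i < j → B.repr b j = 0) ∧
      0 < B.repr b i ∧
      ∀ x ∈ Λ, (∀ j, B.repr x j ∈ Icc (0 : ℝ) 1) → (∀ j, i < j → B.repr x j = 0) →
        0 < B.repr x i → B.repr b i ≤ B.repr x i := by
    intro i
    let S : Set E := {x | x ∈ Λ ∧ (∀ j, B.repr x j ∈ Icc (0 : ℝ) 1) ∧
      (∀ j, i < j → B.repr x j = 0) ∧ 0 < B.repr x i}
    have hSfin : S.Finite := (hΛ _ hbdd).subset fun x hx => ⟨hx.2.1, hx.1⟩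
    have hSne : S.Nonempty := by
      refine ⟨B i, hB i, fun j => ?_, fun j hj => ?_, ?_⟩
      · rw [B.repr_self_apply]; split_ifs <;> simp
      · rw [B.repr_self_apply, if_neg hj.ne]
      · simp
    obtain ⟨b, hb, hle⟩ := Set.exists_min_image S (fun x => B.repr x i) hSfin hSne
    exact ⟨b, hb.1, hb.2.1, hb.2.2.1, hb.2.2.2, fun x h₁ h₂ h₃ h₄ => hle x ⟨h₁, h₂, h₃, h₄⟩⟩
  choose b hbΛ hb01 hb0 hbpos hble using hmin
  have hdvd : ∀ i, ∀ x ∈ Λ, (∀ j, i < j → B.repr x j = 0) →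
      ∃ q : ℤ, B.repr x i = q * B.repr (b i) i := by
    intro i x hx hx0
    set c := B.repr (b i) i with hc
    have hcpos : 0 < c := hbpos i
    set q : ℤ := ⌊B.repr x i / c⌋
    refine ⟨q, ?_⟩
    have h1 : (q : ℝ) * c ≤ B.repr x i := (le_div_iff₀ hcpos).1 (Int.floor_le _)
    have h2 : B.repr x i < (q + 1) * c := (div_lt_iff₀ hcpos).1 (Int.lt_floor_add_one _)
    by_contra hne
    have h3 : 0 < B.repr x i - q * c := sub_pos.2 (lt_of_le_of_ne h1 (Ne.symm hne))
    set y : E := x - q • b i with hy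
    have hyΛ : y ∈ Λ := Λ.sub_mem hx (Λ.smul_mem _ (hbΛ i))
    have hyrepr : ∀ j, B.repr y j = B.repr x j - q * B.repr (b i) j := by
      intro j
      simp [hy, ← Int.cast_smul_eq_zsmul ℝ]
    set m : Fin n → ℤ := fun j => if j < i then ⌊B.repr y j⌋ else 0 with hm
    set w : E := y - ∑ j, m j • B j with hw
    have hwΛ : w ∈ Λ := Λ.sub_mem hyΛ (Λ.sum_mem fun j _ => Λ.smul_mem _ (hB j))
    have hwrepr : ∀ j, B.repr w j = B.repr y j - m j := by
      intro j
      have : ∑ k, m k • B k = ∑ k, (m k : ℝ) • B k := by simp [Int.cast_smul_eq_zsmul]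
      rw [hw, this, map_sub, Finsupp.sub_apply, B.repr_sum_self]
    have hwi : B.repr w i = B.repr x i - q * c := by simp [hwrepr, hyrepr, hm, hc]
    have hwgt : ∀ j, i < j → B.repr w j = 0 := by
      intro j hj
      simp [hwrepr, hyrepr, hm, not_lt.2 hj.le, hx0 j hj, hb0 i j hj]
    have hlt : B.repr w i < c := by rw [hwi]; linarith
    refine hlt.not_ge (hble i w hwΛ (fun j => ?_) hwgt (by rw [hwi]; exact h3))
    rcases lt_trichotomy j i with hj | rfl | hj
    · rw [hwrepr]
      simp only [hm, if_pos hj]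
      exact ⟨Int.fract_nonneg _, (Int.fract_lt_one _).le⟩
    · exact ⟨by rw [hwi]; exact h3.le, hlt.le.trans (hb01 j j).2⟩
    · simp [hwgt j hj]
  refine ⟨b, hb01, le_antisymm (Submodule.span_le.2 (range_subset_iff.2 hbΛ)) ?_⟩
  have key : ∀ k : ℕ, ∀ x ∈ Λ, (∀ j : Fin n, k ≤ j → B.repr x j = 0) →
      x ∈ Submodule.span ℤ (range b) := by
    intro k
    induction k with
    | zero =>
      intro x _ h0
      have : x = 0 := B.ext_elem fun j => by simp [h0 j (Nat.zero_le _)]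
      simp [this]
    | succ k ih =>
      intro x hx h0
      by_cases hk : k < n
      · obtain ⟨q, hq⟩ := hdvd ⟨k, hk⟩ x hx fun j hj => h0 j hj
        have hbk : b ⟨k, hk⟩ ∈ Submodule.span ℤ (range b) := Submodule.subset_span ⟨_, rfl⟩
        have := ih (x - q • b ⟨k, hk⟩) (Λ.sub_mem hx (Λ.smul_mem _ (hbΛ _))) fun j hj => by
          have hr : B.repr (x - q • b ⟨k, hk⟩) j = B.repr x j - q * B.repr (b ⟨k, hk⟩) j := by
            simp [← Int.cast_smul_eq_zsmul ℝ]
          rw [hr]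
          rcases hj.eq_or_lt with h | h
          · obtain rfl : j = ⟨k, hk⟩ := Fin.ext h.symm
            rw [hq, sub_self]
          · rw [h0 j h, hb0 ⟨k, hk⟩ j h]; simp
        simpa using Submodule.add_mem _ this (Submodule.smul_mem _ q hbk)
      · exact ih x hx fun j hj => absurd j.2 (by omega)
  exact fun x hx => key n x hx fun j hj => absurd j.2 (by omega)

theorem intPoints_eq_span (n : ℕ) :
    intPoints n =
      (Submodule.span ℤ (range (EuclideanSpace.basisFun (Fin n) ℝ).toBasis) : Set (Euc n)) := by
  ext x
  rw [SetLike.mem_coe, Module.Basis.mem_span_iff_repr_mem]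
  simp [intPoints, eq_comm]

theorem image_intPoints_eq_span {n : ℕ} (T : Euc n →ₗ[ℝ] Euc n) :
    T '' intPoints n =
      (Submodule.span ℤ (range fun i => T (EuclideanSpace.single i 1)) : Set (Euc n)) := by
  have h := Submodule.map_span (T.restrictScalars ℤ)
    (range (EuclideanSpace.basisFun (Fin n) ℝ).toBasis)
  rw [← range_comp] at h
  have hT : (fun i => T (EuclideanSpace.single i 1)) =
      T.restrictScalars ℤ ∘ (EuclideanSpace.basisFun (Fin n) ℝ).toBasis := by
    funext i
    simp
  rw [intPoints_eq_span, hT, ← h]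
  rfl

theorem isCoveringLattice_unitBall_iff {n : ℕ} (T : Euc n →ₗ[ℝ] Euc n) :
    IsCoveringLattice T (unitBall n) ↔ ∀ x, ∃ z ∈ intPoints n, ‖x - T z‖ ≤ 1 := by
  simp [IsCoveringLattice, unitBall, eq_univ_iff_forall, ← dist_eq_norm]

theorem exists_det_eq_det_mul_intCast {n : ℕ} {T T' : Euc n →ₗ[ℝ] Euc n}
    (h : T '' intPoints n ⊆ T' '' intPoints n) :
    ∃ m : ℤ, LinearMap.det T = LinearMap.det T' * m := by
  have hT : ∀ i, ∃ a ∈ intPoints n, T' a = T (EuclideanSpace.single i 1) := fun i =>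
    h ⟨_, fun j => ⟨if j = i then 1 else 0, by simp⟩, rfl⟩
  choose a ha hTa using hT
  choose A hA using ha
  set N : Matrix (Fin n) (Fin n) ℤ := Matrix.of fun j i => A i j with hN
  have hcomp : T = T' ∘ₗ Matrix.toLpLin 2 2 (N.map (Int.castRingHom ℝ)) := by
    refine (EuclideanSpace.basisFun (Fin n) ℝ).toBasis.ext fun i => ?_
    have : Matrix.toLpLin 2 2 (N.map (Int.castRingHom ℝ)) (EuclideanSpace.single i 1) = a i := by
      ext j
      simp [hN, hA]
    rw [OrthonormalBasis.coe_toBasis, EuclideanSpace.basisFun_apply, LinearMap.comp_apply, this,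
      hTa]
  refine ⟨N.det, ?_⟩
  rw [hcomp, LinearMap.det_comp, LinearMap.det_toLpLin, ← RingHom.mapMatrix_apply,
    ← RingHom.map_det]
  simp

theorem abs_det_eq_of_image_intPoints_eq {n : ℕ} {T T' : Euc n →ₗ[ℝ] Euc n}
    (h : T '' intPoints n = T' '' intPoints n) :
    |LinearMap.det T| = |LinearMap.det T'| := by
  obtain ⟨m, hm⟩ := exists_det_eq_det_mul_intCast h.le
  obtain ⟨m', hm'⟩ := exists_det_eq_det_mul_intCast h.ge
  by_cases h0 : LinearMap.det T = 0
  · rw [hm', h0, zero_mul]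
  have h1 : (m' : ℝ) * m = 1 := by
    rw [hm'] at hm
    refine mul_left_cancel₀ h0 ?_
    linarith
  have h2 : m' * m = 1 := by exact_mod_cast h1
  have h3 : |(m : ℝ)| = 1 := by
    have := Int.isUnit_iff_abs_eq.1 (IsUnit.of_mul_eq_one_right m' h2)
    exact_mod_cast this
  rw [hm, abs_mul, h3, mul_one]

/-- Every covering lattice of the unit ball has a basis bounded in terms of the dimension only. -/
theorem exists_matrix_entries_le_of_isCoveringLattice {n : ℕ} (T : Euc n →ₗ[ℝ] Euc n)
    (hT : LinearMap.det T ≠ 0) (hcov : IsCoveringLattice T (unitBall n)) :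
    ∃ M : Matrix (Fin n) (Fin n) ℝ, (∀ i j, |M i j| ≤ n * (n + 2)) ∧
      Matrix.toLpLin 2 2 M '' intPoints n = T '' intPoints n := by
  rw [isCoveringLattice_unitBall_iff] at hcov
  choose z hz hcov using fun i => hcov (EuclideanSpace.single i ((n : ℝ) + 1))
  have hcoord : ∀ i k, |EuclideanSpace.single i ((n : ℝ) + 1) k - T (z i) k| ≤ 1 := fun i k =>
    (PiLp.norm_apply_le (EuclideanSpace.single i ((n : ℝ) + 1) - T (z i)) k).trans (hcov i)
  set V : Matrix (Fin n) (Fin n) ℝ := Matrix.of fun i k => T (z i) k with hV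
  have hVdet : V.det ≠ 0 := by
    refine det_ne_zero_of_sum_row_lt_diag fun k => ?_
    have hdiag : (n : ℝ) ≤ ‖V k k‖ := by
      have := abs_le.1 (hcoord k k)
      simp only [PiLp.single_apply, if_true] at this
      refine le_trans ?_ (le_abs_self _)
      simp only [hV, Matrix.of_apply]
      linarith
    have hoff : ∑ j ∈ Finset.univ.erase k, ‖V k j‖ ≤ ∑ j ∈ Finset.univ.erase k, (1 : ℝ) := by
      refine Finset.sum_le_sum fun j hj => ?_
      have := hcoord k j
      rw [PiLp.single_apply, if_neg (Finset.ne_of_mem_erase hj), zero_sub, abs_neg]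
        at this
      exact this
    refine (hoff.trans_lt ?_).trans_le hdiag
    have hn : 0 < n := k.pos
    rw [Finset.sum_const, nsmul_one, Finset.card_erase_of_mem (Finset.mem_univ k),
      Finset.card_univ, Fintype.card_fin]
    exact_mod_cast Nat.sub_lt hn one_pos
  have hVli : LinearIndependent ℝ fun i => T (z i) := by
    have := (Matrix.linearIndependent_rows_of_det_ne_zero hVdet).map'
      (WithLp.linearEquiv 2 ℝ (Fin n → ℝ)).symm.toLinearMap (LinearEquiv.ker _)
    exact this
  have hVle : ∀ i k, |T (z i) k| ≤ n + 2 := fun i k => by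
    have h1 := abs_le.1 (hcoord i k)
    have h2 : 0 ≤ EuclideanSpace.single i ((n : ℝ) + 1) k ∧
        EuclideanSpace.single i ((n : ℝ) + 1) k ≤ n + 1 := by
      rw [PiLp.single_apply]
      split_ifs <;> constructor <;> first | positivity | exact le_rfl
    rw [abs_le]
    constructor <;> linarith
  let B : Module.Basis (Fin n) ℝ (Euc n) :=
    basisOfLinearIndependentOfCardEqFinrank' _ hVli (by simp)
  have hB : ∀ i, B i = T (z i) := fun i => by simp [B]
  let e : Module.Basis (Fin n) ℝ (Euc n) :=
    (EuclideanSpace.basisFun (Fin n) ℝ).toBasis.map (LinearEquiv.ofIsUnitDet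
      (f := T) (v := (EuclideanSpace.basisFun (Fin n) ℝ).toBasis)
      (v' := (EuclideanSpace.basisFun (Fin n) ℝ).toBasis)
      (by rw [LinearMap.det_toMatrix]; exact hT.isUnit))
  have he : ∀ i, e i = T (EuclideanSpace.single i 1) := fun i => by simp [e]
  have hΛ : T '' intPoints n = (Submodule.span ℤ (range e) : Set (Euc n)) := by
    rw [image_intPoints_eq_span, funext he]
  obtain ⟨b, hb, hspan⟩ := exists_reduced_generators (Submodule.span ℤ (range e))
    (fun s hs => ZSpan.setFinite_inter e hs) B fun i => by
      rw [← SetLike.mem_coe, ← hΛ, hB]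
      exact mem_image_of_mem T (hz i)
  refine ⟨Matrix.of fun k i => b i k, fun k i => ?_, ?_⟩
  · have h1 : b i k = ∑ j, B.repr (b i) j * T (z j) k := by
      conv_lhs => rw [← B.sum_repr (b i)]
      simp [hB]
    rw [Matrix.of_apply, h1]
    calc |∑ j, B.repr (b i) j * T (z j) k| ≤ ∑ j, |B.repr (b i) j * T (z j) k| :=
          Finset.abs_sum_le_sum_abs _ _
      _ ≤ ∑ _j : Fin n, ((n : ℝ) + 2) := by
          refine Finset.sum_le_sum fun j _ => ?_
          rw [abs_mul, abs_of_nonneg (hb i j).1]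
          exact (mul_le_of_le_one_left (abs_nonneg _) (hb i j).2).trans (hVle j k)
      _ = n * (n + 2) := by simp [mul_add]
  · rw [hΛ, ← hspan, image_intPoints_eq_span]
    congr 4
    ext i k
    simp

theorem isClosed_intPoints (n : ℕ) : IsClosed (intPoints n) := by
  have : intPoints n = ⋂ i, (fun x : Euc n => x i) ⁻¹' range ((↑) : ℤ → ℝ) := by
    ext x
    simp [intPoints, eq_comm]
  rw [this]
  exact isClosed_iInter fun i => Int.isClosedEmbedding_coe_real.isClosed_range.preimage
    (by fun_prop)

theorem continuous_toLpLin_apply {n : ℕ} :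
    Continuous fun p : Matrix (Fin n) (Fin n) ℝ × Euc n => Matrix.toLpLin 2 2 p.1 p.2 := by
  simp only [Matrix.toLpLin_apply]
  fun_prop

open Filter Topology in
theorem isCoveringLattice_unitBall_of_tendsto {n : ℕ} {M : ℕ → Matrix (Fin n) (Fin n) ℝ}
    {M' : Matrix (Fin n) (Fin n) ℝ} (hM : Tendsto M atTop (𝓝 M')) (hdet : M'.det ≠ 0)
    (hcov : ∀ k, IsCoveringLattice (Matrix.toLpLin 2 2 (M k)) (unitBall n)) :
    IsCoveringLattice (Matrix.toLpLin 2 2 M') (unitBall n) := by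
  simp only [isCoveringLattice_unitBall_iff] at hcov ⊢
  intro x
  choose z hz hx using fun k => hcov k x
  have hmem : ∀ k, Matrix.toLpLin 2 2 (M k) (z k) ∈ Metric.closedBall x 1 := fun k => by
    rw [Metric.mem_closedBall, dist_comm, dist_eq_norm]
    exact hx k
  obtain ⟨l, hl, φ, hφ, hlim⟩ := (isCompact_closedBall x 1).tendsto_subseq hmem
  have hinv : Tendsto (fun k => (M (φ k))⁻¹) atTop (𝓝 M'⁻¹) := by
    have h1 : ContinuousAt (fun A : Matrix (Fin n) (Fin n) ℝ => A⁻¹) M' := by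
      simp only [Matrix.inv_def, Ring.inverse_eq_inv']
      exact ((by fun_prop : Continuous fun A : Matrix (Fin n) (Fin n) ℝ =>
        A.det).continuousAt.inv₀ hdet).smul (by fun_prop)
    exact h1.tendsto.comp (hM.comp hφ.tendsto_atTop)
  have hne : ∀ᶠ k in atTop, (M (φ k)).det ≠ 0 :=
    (((by fun_prop : Continuous fun A : Matrix (Fin n) (Fin n) ℝ => A.det).tendsto M').comp
      (hM.comp hφ.tendsto_atTop)).eventually_ne hdet
  have hzlim : Tendsto (fun k => z (φ k)) atTop (𝓝 (Matrix.toLpLin 2 2 M'⁻¹ l)) := by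
    refine ((continuous_toLpLin_apply.tendsto (M'⁻¹, l)).comp
      (hinv.prodMk_nhds hlim)).congr' ?_
    filter_upwards [hne] with k hk
    simp [Matrix.toLpLin_apply, Matrix.nonsing_inv_mul _ hk.isUnit]
  refine ⟨_, (isClosed_intPoints n).mem_of_tendsto hzlim (Eventually.of_forall fun k => hz _), ?_⟩
  have : Matrix.toLpLin 2 2 M' (Matrix.toLpLin 2 2 M'⁻¹ l) = l := by
    simp [Matrix.toLpLin_apply, Matrix.mul_nonsing_inv _ hdet.isUnit]
  rw [this, ← dist_eq_norm, dist_comm]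
  exact hl

theorem hsNorm_toLpLin {n : ℕ} (M : Matrix (Fin n) (Fin n) ℝ) :
    hsNorm (Matrix.toLpLin 2 2 M) = √(M.conjTranspose * M).trace := by
  rw [hsNorm, ← Matrix.toEuclideanLin_conjTranspose_eq_adjoint, ← Matrix.toLpLin_mul_same,
    Matrix.toLpLin_eq_toLin, Matrix.trace_toLin_eq]

/-- Stability of the optimal ball covering: if `Λ₀ = T₀(ℤⁿ)` is a covering lattice of `Bⁿ`
such that every covering lattice of `Bⁿ` with determinant at least `d(Λ₀)` is a rotation of
`Λ₀`, then every covering lattice of `Bⁿ` with determinant close to `d(Λ₀)` is close (in the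
lattice metric `δ`) to some rotation of `Λ₀`. -/
theorem nearly_optimal_covering_lattice_near_rotation {n : ℕ} (hn : 2 ≤ n)
    (T₀ : Euc n →ₗ[ℝ] Euc n) (hT₀ : LinearMap.det T₀ ≠ 0)
    (hcov : IsCoveringLattice T₀ (unitBall n))
    (huniq : ∀ T : Euc n →ₗ[ℝ] Euc n, LinearMap.det T ≠ 0 →
      IsCoveringLattice T (unitBall n) → |LinearMap.det T₀| ≤ |LinearMap.det T| →
      ∃ U : Euc n ≃ₗᵢ[ℝ] Euc n, LinearMap.det U.toLinearEquiv.toLinearMap = 1 ∧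
        T '' intPoints n = (U.toLinearEquiv.toLinearMap ∘ₗ T₀) '' intPoints n) :
    ∀ ε : ℝ, 0 < ε → ∃ ε' : ℝ, 0 < ε' ∧
      ∀ T : Euc n →ₗ[ℝ] Euc n, LinearMap.det T ≠ 0 →
        IsCoveringLattice T (unitBall n) →
        |LinearMap.det T₀| - ε' < |LinearMap.det T| →
        ∃ U : Euc n ≃ₗᵢ[ℝ] Euc n, LinearMap.det U.toLinearEquiv.toLinearMap = 1 ∧
          ∃ T₁ T₂ : Euc n →ₗ[ℝ] Euc n,
            T₁ '' intPoints n = T '' intPoints n ∧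
            T₂ '' intPoints n = (U.toLinearEquiv.toLinearMap ∘ₗ T₀) '' intPoints n ∧
            hsNorm (T₁ - T₂) < ε := by
  intro ε hε
  by_contra! hbad
  choose T hdet hTcov hdetlt hfar using fun k : ℕ => hbad (1 / (k + 1)) Nat.one_div_pos_of_nat
  choose M hMle hM using fun k =>
    exists_matrix_entries_le_of_isCoveringLattice (T k) (hdet k) (hTcov k)
  have hMmem : ∀ k, M k ∈ (Set.univ.pi fun _ => Set.univ.pi fun _ =>
      Icc (-((n : ℝ) * (n + 2))) (n * (n + 2)) : Set (Fin n → Fin n → ℝ)) :=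
    fun k i _ j _ => abs_le.1 (hMle k i j)
  obtain ⟨M', -, φ, hφ, hlim⟩ := (isCompact_univ_pi fun _ => isCompact_univ_pi fun _ =>
    isCompact_Icc).tendsto_subseq hMmem
  change Matrix (Fin n) (Fin n) ℝ at M'
  have hMcov : ∀ k, IsCoveringLattice (Matrix.toLpLin 2 2 (M k)) (unitBall n) := fun k => by
    rw [IsCoveringLattice, hM k]
    exact hTcov k
  have hdetlim : Filter.Tendsto (fun k => |(M (φ k)).det|) Filter.atTop (nhds |M'.det|) :=
    ((by fun_prop : Continuous fun A : Matrix (Fin n) (Fin n) ℝ => |A.det|).tendsto M').comp hlim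
  have hdetle : |LinearMap.det T₀| ≤ |M'.det| := by
    have hlow : Filter.Tendsto (fun k : ℕ => |LinearMap.det T₀| - 1 / ((φ k : ℝ) + 1))
        Filter.atTop (nhds (|LinearMap.det T₀| - 0)) :=
      tendsto_const_nhds.sub (tendsto_one_div_add_atTop_nhds_zero_nat.comp hφ.tendsto_atTop)
    rw [sub_zero] at hlow
    refine le_of_tendsto_of_tendsto' hlow hdetlim fun k => ?_
    rw [← LinearMap.det_toLpLin 2 (M (φ k)), abs_det_eq_of_image_intPoints_eq (hM (φ k))]
    exact (hdetlt (φ k)).le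
  have hM'det : M'.det ≠ 0 := abs_pos.1 ((abs_pos.2 hT₀).trans_le hdetle)
  obtain ⟨U, hU, hUim⟩ := huniq (Matrix.toLpLin 2 2 M') (by rwa [LinearMap.det_toLpLin])
    (isCoveringLattice_unitBall_of_tendsto hlim hM'det fun k => hMcov (φ k))
    (by rwa [LinearMap.det_toLpLin])
  have hnorm : Filter.Tendsto
      (fun k => hsNorm (Matrix.toLpLin 2 2 (M (φ k)) - Matrix.toLpLin 2 2 M'))
      Filter.atTop (nhds 0) := by
    have hcont : Continuous fun A : Matrix (Fin n) (Fin n) ℝ =>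
        √((A - M').conjTranspose * (A - M')).trace := by fun_prop
    have := (hcont.tendsto M').comp hlim
    simp only [sub_self, Matrix.mul_zero, Matrix.trace_zero, Real.sqrt_zero] at this
    simp only [← map_sub, hsNorm_toLpLin]
    exact this
  obtain ⟨k, hk⟩ := (hnorm.eventually_lt_const hε).exists
  exact (hfar (φ k) U hU _ _ (hM (φ k)) hUim).not_gt hk
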